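/- Let N ≥ 1, 0 < β < 1 and 1 ≤ q < ∞. There exists a constant C = C(N,β,q) > 0 such that for every open bounded set Ω ⊂ ℝ^N and every φ ∈ C_c^∞(Ω) one has ‖φ‖_{L^q(ℝ^N)}^q ≤ C |Ω|^{βq/N} [φ]_{W^{β,q}(ℝ^N)}^q, where |Ω| is the Lebesgue measure of Ω. -/

import Mathlib

open MeasureTheory Metric ENNReal

abbrev Euc (N : ℕ) := EuclideanSpace ℝ (Fin N)

/-- `φ` is a `C_c^∞` test function supported in `A`. -/
def IsTest {N : ℕ} (A : Set (Euc N)) (φ : Euc N → ℝ) : Prop :=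
  ContDiff ℝ (⊤ : ℕ∞) φ ∧ HasCompactSupport φ ∧ tsupport φ ⊆ A

/-- The Gagliardo seminorm raised to the power `q`. -/
noncomputable def gagliardoQ {N : ℕ} (β q : ℝ) (A : Set (Euc N)) (ψ : Euc N → ℝ) : ℝ≥0∞ :=
  ∫⁻ x in A, ∫⁻ y in A, ENNReal.ofReal (|ψ x - ψ y| ^ q / ‖x - y‖ ^ ((N : ℝ) + β * q))

/-- A ball of twice the volume of `Ω` leaves at least the volume of `Ω` outside of `Ω`. -/
lemma ofReal_le_volume_ball_diff {N : ℕ} (hN : 1 ≤ N) {Ω : Set (Euc N)} {V R : ℝ} (hV : 0 ≤ V)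
    (hR : 0 ≤ R) (hΩ : volume Ω = ENNReal.ofReal V)
    (hRV : R ^ N * (volume (ball (0 : Euc N) 1)).toReal = 2 * V) (x : Euc N) :
    ENNReal.ofReal V ≤ volume (ball x R \ Ω) := by
  have : Nonempty (Fin N) := ⟨⟨0, hN⟩⟩
  have hball : volume (ball x R) = ENNReal.ofReal (2 * V) := by
    rw [Measure.addHaar_ball volume x hR, ← hRV, ENNReal.ofReal_mul (by positivity),
      ENNReal.ofReal_toReal measure_ball_lt_top.ne]
    simp
  calc ENNReal.ofReal V = volume (ball x R) - volume Ω := by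
        rw [hball, hΩ, ← ENNReal.ofReal_sub _ hV]
        congr 1
        ring
    _ ≤ volume (ball x R \ Ω) := le_measure_sdiff

/-- The inner Gagliardo integral at `x ∈ Ω` is at least the contribution of the points of a ball
around `x` lying outside of `Ω`, where `φ` vanishes. -/
lemma ofReal_mul_volume_le_lintegral {N : ℕ} {q s R : ℝ} (hs : 0 ≤ s) {Ω : Set (Euc N)}
    (hΩ : IsOpen Ω) {φ : Euc N → ℝ} (hφ : ∀ y ∉ Ω, φ y = 0) {x : Euc N} (hx : x ∈ Ω) :
    ENNReal.ofReal (|φ x| ^ q / R ^ s) * volume (ball x R \ Ω) ≤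
      ∫⁻ y, ENNReal.ofReal (|φ x - φ y| ^ q / ‖x - y‖ ^ s) := by
  rw [← setLIntegral_const]
  refine (setLIntegral_mono' (measurableSet_ball.diff hΩ.measurableSet) ?_).trans
    (setLIntegral_le_lintegral _ _)
  rintro y ⟨hyR, hy⟩
  have hxy : 0 < ‖x - y‖ := norm_pos_iff.2 (sub_ne_zero.2 fun h => hy (h ▸ hx))
  have hyR' : ‖x - y‖ ≤ R := by
    rw [← dist_eq_norm, dist_comm]
    exact (mem_ball.1 hyR).le
  rw [hφ y hy, sub_zero]
  gcongr

/-- fractional Poincaré inequality: for `N ≥ 1`, `0 < β < 1`, `1 ≤ q < ∞`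
there is `C = C(N,β,q) > 0` such that for every open bounded `Ω ⊂ ℝ^N` and every
`φ ∈ C_c^∞(Ω)` one has `‖φ‖_{L^q}^q ≤ C |Ω|^{βq/N} [φ]_{W^{β,q}(ℝ^N)}^q`. -/
theorem statement11 (N : ℕ) (hN : 1 ≤ N) (β q : ℝ) (hβ0 : 0 < β) (hβ1 : β < 1) (hq : 1 ≤ q) :
    ∃ C : ℝ, 0 < C ∧ ∀ Ω : Set (Euc N), IsOpen Ω → Bornology.IsBounded Ω →
      ∀ φ : Euc N → ℝ, IsTest Ω φ →
        (∫⁻ x, ENNReal.ofReal (|φ x| ^ q)) ≤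
          ENNReal.ofReal C * (volume Ω) ^ (β * q / N) * gagliardoQ β q Set.univ φ := by
  set ω : ℝ := (volume (ball (0 : Euc N) 1)).toReal
  have hωpos : 0 < ω :=
    ENNReal.toReal_pos (measure_ball_pos _ _ one_pos).ne' measure_ball_lt_top.ne
  have hNpos : (0 : ℝ) < N := by exact_mod_cast hN
  have hq0 : 0 < q := by linarith
  refine ⟨(2 / ω) ^ (1 + β * q / N), by positivity, fun Ω hΩ hbdd φ hφ => ?_⟩
  have hzero : ∀ y ∉ Ω, φ y = 0 := fun y hy => image_eq_zero_of_notMem_tsupport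
    fun h => hy (hφ.2.2 h)
  rcases Ω.eq_empty_or_nonempty with rfl | hne
  · have : ∀ x, φ x = 0 := fun x => hzero x (Set.notMem_empty x)
    simp [this, Real.zero_rpow hq0.ne']
  have hfin : volume Ω ≠ ∞ := hbdd.measure_lt_top.ne
  set V : ℝ := (volume Ω).toReal
  have hV : 0 < V := ENNReal.toReal_pos (hΩ.measure_pos volume hne).ne' hfin
  have hvol : volume Ω = ENNReal.ofReal V := (ENNReal.ofReal_toReal hfin).symm
  set R : ℝ := (2 / ω * V) ^ (1 / (N : ℝ)) with hRdef
  have hRpos : 0 < R := by positivity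
  have hRN : R ^ N * ω = 2 * V := by
    rw [hRdef, ← Real.rpow_natCast, ← Real.rpow_mul (by positivity), one_div_mul_cancel hNpos.ne',
      Real.rpow_one]
    field_simp
  have hRs : R ^ ((N : ℝ) + β * q) = (2 / ω) ^ (1 + β * q / N) * V ^ (β * q / N) * V := by
    rw [hRdef, ← Real.rpow_mul (by positivity),
      show 1 / (N : ℝ) * (N + β * q) = 1 + β * q / N by field_simp,
      Real.mul_rpow (by positivity) hV.le, Real.rpow_add hV, Real.rpow_one]
    ring
  rw [hvol, ENNReal.ofReal_rpow_of_pos hV, ← ENNReal.ofReal_mul (by positivity)]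
  simp only [gagliardoQ, Measure.restrict_univ]
  rw [← lintegral_const_mul' _ _ ENNReal.ofReal_ne_top]
  refine lintegral_mono fun x => ?_
  by_cases hx : x ∈ Ω
  · calc ENNReal.ofReal (|φ x| ^ q)
        = ENNReal.ofReal ((2 / ω) ^ (1 + β * q / N) * V ^ (β * q / N)) *
          (ENNReal.ofReal (|φ x| ^ q / R ^ ((N : ℝ) + β * q)) * ENNReal.ofReal V) := by
          rw [← ENNReal.ofReal_mul (by positivity), ← ENNReal.ofReal_mul (by positivity), hRs]
          congr 1
          field_simp
      _ ≤ _ := by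
          gcongr
          exact (mul_le_mul_right
            (ofReal_le_volume_ball_diff hN hV.le hRpos.le hvol hRN x) _).trans
            (ofReal_mul_volume_le_lintegral (by positivity) hΩ hzero hx)
  · simp [hzero x hx, Real.zero_rpow hq0.ne']
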